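/- There is a group isomorphism HQ(A,σ,Eˣ) ≅ H²(A ⋊_σ ℤ, Eˣ), where the right-hand side is the second group cohomology of the semidirect product A ⋊_σ ℤ with coefficients in the trivial module Eˣ. (This combines Proposition 3.4 of the paper — the isomorphism S_G from isomorphism classes of quasicharacter sheaves on an étale group scheme to the second cohomology of the total complex — with part (2) of the Proposition in Section 3.2 identifying the cohomology of the total complex with the cohomology of W ⋉ Ḡ.) -/

import Mathlib

/-! Basic setup: cocycle description of quasicharacter sheaves on étale
commutative group schemes, following the paper's stalk description. -/

section QCS

variable (A : Type) [AddCommGroup A] (M : Type) [CommGroup M]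

/-- The 2-cocycle condition for a function `a : A × A → M` (trivial action). -/
def IsCocycle (a : A → A → M) : Prop :=
  ∀ x y z : A, a (x + y) z * a x y = a x (y + z) * a y z

/-- The coboundary of a function `d : A → M`. -/
def cobound (d : A → M) : A → A → M :=
  fun x y => d (x + y) * (d x)⁻¹ * (d y)⁻¹

/-- The group of 2-cocycles `Z²(A,M)`. -/
def Z2 : Subgroup (A → A → M) where
  carrier := {a | IsCocycle A M a}
  one_mem' := by intro x y z; simp
  mul_mem' := by
    intro a b ha hb
    intro x y z
    simp only [Pi.mul_apply]
    rw [mul_mul_mul_comm, ha x y z, hb x y z, mul_mul_mul_comm]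
  inv_mem' := by
    intro a ha
    intro x y z
    simp only [Pi.inv_apply]
    rw [← mul_inv, ← mul_inv, ha x y z]

lemma mem_Z2_iff {a : A → A → M} : a ∈ Z2 A M ↔ IsCocycle A M a := Iff.rfl

/-- The coboundary map, as a homomorphism. -/
def coboundHom : (A → M) →* (A → A → M) where
  toFun := cobound A M
  map_one' := by funext x y; simp [cobound]
  map_mul' := by
    intro d e
    funext x y
    simp only [cobound, Pi.mul_apply, mul_inv]
    simp [mul_comm, mul_left_comm, mul_assoc]

/-- The group of 2-coboundaries `B²(A,M)`. -/
def B2 : Subgroup (A → A → M) := (coboundHom A M).range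

/-- The second cohomology group `H²(A,M)` (trivial action). -/
abbrev H2 : Type := Z2 A M ⧸ (B2 A M).subgroupOf (Z2 A M)

variable (σ : A ≃+ A)

/-- The compatibility condition between a 2-cocycle `a` and a 1-cochain `b`
relative to the automorphism `σ`. -/
def IsCompat (a : A → A → M) (b : A → M) : Prop :=
  ∀ x y : A, a (σ x) (σ y) * (a x y)⁻¹ = b (x + y) * (b x)⁻¹ * (b y)⁻¹

/-- The group `ZQ(A,σ,M)` of quasicharacter data. -/
def ZQ : Subgroup ((A → A → M) × (A → M)) where
  carrier := {p | IsCocycle A M p.1 ∧ IsCompat A M σ p.1 p.2}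
  one_mem' := ⟨fun x y z => by simp, fun x y => by simp⟩
  mul_mem' := by
    rintro p q ⟨hp1, hp2⟩ ⟨hq1, hq2⟩
    refine ⟨mul_mem (show p.1 ∈ Z2 A M from hp1) (show q.1 ∈ Z2 A M from hq1), ?_⟩
    intro x y
    have key : (p.1 (σ x) (σ y) * (p.1 x y)⁻¹) * (q.1 (σ x) (σ y) * (q.1 x y)⁻¹)
        = (p.2 (x + y) * (p.2 x)⁻¹ * (p.2 y)⁻¹) * (q.2 (x + y) * (q.2 x)⁻¹ * (q.2 y)⁻¹) := by
      rw [hp2 x y, hq2 x y]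
    simpa [Prod.fst_mul, Prod.snd_mul, Pi.mul_apply, mul_inv, mul_comm, mul_left_comm,
      mul_assoc] using key
  inv_mem' := by
    rintro p ⟨hp1, hp2⟩
    refine ⟨inv_mem (show p.1 ∈ Z2 A M from hp1), ?_⟩
    intro x y
    have key := congrArg (·⁻¹) (hp2 x y)
    simpa [Prod.fst_inv, Prod.snd_inv, Pi.inv_apply, mul_inv, mul_comm, mul_left_comm,
      mul_assoc] using key

lemma mem_ZQ_iff {p : (A → A → M) × (A → M)} :
    p ∈ ZQ A M σ ↔ IsCocycle A M p.1 ∧ IsCompat A M σ p.1 p.2 := Iff.rfl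

/-- The map `d ↦ (x ↦ d(σ x)·d(x)⁻¹)`, as a homomorphism. -/
def sigmaDiff : (A → M) →* (A → M) where
  toFun d := fun x => d (σ x) * (d x)⁻¹
  map_one' := by funext x; simp
  map_mul' := by
    intro d e
    funext x
    simp only [Pi.mul_apply, mul_inv]
    simp [mul_comm, mul_left_comm, mul_assoc]

/-- The subgroup `BQ(A,σ,M)` of coboundary quasicharacter data. -/
def BQ : Subgroup ((A → A → M) × (A → M)) :=
  ((coboundHom A M).prod (sigmaDiff A M σ)).range

/-- `HQ(A,σ,M)`: the group of quasicharacter data modulo coboundaries. -/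
abbrev HQ : Type := ZQ A M σ ⧸ (BQ A M σ).subgroupOf (ZQ A M σ)

/-- The subgroup `A^σ` of fixed points of `σ`. -/
def fixedAdd : AddSubgroup A where
  carrier := {x | σ x = x}
  zero_mem' := by simp
  add_mem' := by
    intro a b ha hb
    simp only [Set.mem_setOf_eq] at *
    rw [map_add, ha, hb]
  neg_mem' := by
    intro a ha
    simp only [Set.mem_setOf_eq] at *
    rw [map_neg, ha]

/-- The restriction of the 1-cochain part of a quasicharacter datum to `A^σ`,
as a character of `A^σ`. -/
def trZ (p : ZQ A M σ) : AddChar (fixedAdd A σ) M where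
  toFun := fun x => (p : (A → A → M) × (A → M)).2 (x : A)
  map_zero_eq_one' := by
    have h := p.prop.2 (0 : A) 0
    simp at h
    simpa using h
  map_add_eq_mul' := by
    rintro ⟨x, hx⟩ ⟨y, hy⟩
    have hx' : σ x = x := hx
    have hy' : σ y = y := hy
    have h := p.prop.2 x y
    rw [hx', hy', mul_inv_cancel] at h
    have h2 : (p : (A → A → M) × (A → M)).2 (x + y)
        * ((p : (A → A → M) × (A → M)).2 x)⁻¹
        * ((p : (A → A → M) × (A → M)).2 y)⁻¹ = 1 := h.symm
    rw [mul_inv_eq_one] at h2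
    rw [mul_inv_eq_iff_eq_mul] at h2
    simpa [mul_comm] using h2

/-- The trace map `ZQ(A,σ,M) → Hom(A^σ, M)`, `(a,b) ↦ b|_{A^σ}`. -/
def trZHom : ZQ A M σ →* AddChar (fixedAdd A σ) M where
  toFun := trZ A M σ
  map_one' := by
    apply AddChar.ext
    intro x
    rfl
  map_mul' := by
    intro p q
    apply AddChar.ext
    intro x
    rfl

lemma trZHom_trivial_on_BQ :
    (BQ A M σ).subgroupOf (ZQ A M σ) ≤ (trZHom A M σ).ker := by
  rintro ⟨p, hpZ⟩ hpB
  obtain ⟨d, hd⟩ := hpB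
  have hd' : ((coboundHom A M).prod (sigmaDiff A M σ)) d = p := hd
  have hd2 : p.2 = fun x => d (σ x) * (d x)⁻¹ := by rw [← hd']; rfl
  apply AddChar.ext
  rintro ⟨x, hx⟩
  have hx' : σ x = x := hx
  show trZ A M σ ⟨p, hpZ⟩ _ = 1
  simp [trZ, hd2, hx']

/-- The trace-of-Frobenius homomorphism `Tr : HQ(A,σ,M) → Hom(A^σ,M)`. -/
def TrHom : HQ A M σ →* AddChar (fixedAdd A σ) M :=
  QuotientGroup.lift _ (trZHom A M σ) (trZHom_trivial_on_BQ A M σ)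

/-- The projection `ZQ(A,σ,M) → Z²(A,M)`, `(a,b) ↦ a`. -/
def zproj : ZQ A M σ →* Z2 A M where
  toFun := fun p => ⟨(p : (A → A → M) × (A → M)).1, p.prop.1⟩
  map_one' := rfl
  map_mul' := fun _ _ => rfl

lemma zproj_trivial_on_BQ :
    (BQ A M σ).subgroupOf (ZQ A M σ) ≤
      ((QuotientGroup.mk' ((B2 A M).subgroupOf (Z2 A M))).comp (zproj A M σ)).ker := by
  rintro ⟨p, hpZ⟩ hpB
  obtain ⟨d, hd⟩ := hpB
  have hd' : ((coboundHom A M).prod (sigmaDiff A M σ)) d = p := hd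
  have hd1 : p.1 = cobound A M d := by rw [← hd']; rfl
  simp only [MonoidHom.mem_ker, MonoidHom.comp_apply]
  rw [QuotientGroup.mk'_apply, QuotientGroup.eq_one_iff]
  show (zproj A M σ ⟨p, hpZ⟩ : A → A → M) ∈ B2 A M
  exact ⟨d, hd1.symm⟩

/-- The map `HQ(A,σ,M) → H²(A,M)` sending `[(a,b)]` to `[a]`. -/
def clsHom : HQ A M σ →* H2 A M :=
  QuotientGroup.lift _ ((QuotientGroup.mk' ((B2 A M).subgroupOf (Z2 A M))).comp (zproj A M σ))
    (zproj_trivial_on_BQ A M σ)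

/-- Precomposition with `σ × σ` on 2-cocycles. -/
def precompZ2 : Z2 A M →* Z2 A M where
  toFun := fun a => ⟨fun x y => (a : A → A → M) (σ x) (σ y), by
    intro x y z
    have := a.prop (σ x) (σ y) (σ z)
    simpa [map_add] using this⟩
  map_one' := rfl
  map_mul' := fun _ _ => rfl

lemma precompZ2_trivial : ((B2 A M).subgroupOf (Z2 A M)) ≤
    (((QuotientGroup.mk' ((B2 A M).subgroupOf (Z2 A M))).comp (precompZ2 A M σ))).ker := by
  rintro ⟨a, haZ⟩ haB
  obtain ⟨d, hd⟩ := haB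
  simp only [MonoidHom.mem_ker, MonoidHom.comp_apply]
  rw [QuotientGroup.mk'_apply, QuotientGroup.eq_one_iff]
  show (precompZ2 A M σ ⟨a, haZ⟩ : A → A → M) ∈ B2 A M
  refine ⟨fun x => d (σ x), ?_⟩
  have hd1 : a = cobound A M d := hd.symm
  funext x y
  show cobound A M (fun x => d (σ x)) x y = a (σ x) (σ y)
  rw [hd1]
  simp [cobound, map_add]

/-- The action of `σ` on `H²(A,M)`, `[a] ↦ [a ∘ (σ × σ)]`. -/
def H2act : H2 A M →* H2 A M :=
  QuotientGroup.lift _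
    ((QuotientGroup.mk' ((B2 A M).subgroupOf (Z2 A M))).comp (precompZ2 A M σ))
    (precompZ2_trivial A M σ)

/-- The subgroup `H²(A,M)^σ` of `σ`-fixed classes. -/
def H2fixed : Subgroup (H2 A M) where
  carrier := {c | H2act A M σ c = c}
  one_mem' := map_one _
  mul_mem' := by
    intro a b ha hb
    simp only [Set.mem_setOf_eq] at *
    rw [map_mul, ha, hb]
  inv_mem' := by
    intro a ha
    simp only [Set.mem_setOf_eq] at *
    rw [map_inv, ha]

end QCS

/-- The action of `ℤ` on `A` (written multiplicatively) in which `n` acts by `σⁿ`. -/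
def sdAct (A : Type) [AddCommGroup A] (σ : A ≃+ A) :
    Multiplicative ℤ →* MulAut (Multiplicative A) :=
  zpowersHom (MulAut (Multiplicative A)) (AddEquiv.toMultiplicative σ)

/-- The semidirect product `A ⋊_σ ℤ`. -/
abbrev sdGroup (A : Type) [AddCommGroup A] (σ : A ≃+ A) : Type :=
  SemidirectProduct (Multiplicative A) (Multiplicative ℤ) (sdAct A σ)

section CentralExtension

variable {G H M : Type*} [Group G] [Group H] [CommGroup M]

/-- A homomorphism intertwining two automorphisms intertwines their powers. -/
lemma MonoidHom.semiconj_zpow (p : G →* H) {e : MulAut G} {e' : MulAut H}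
    (h : ∀ g, p (e g) = e' (p g)) (n : ℤ) (g : G) : p ((e ^ n) g) = (e' ^ n) (p g) := by
  have hinv : ∀ g, p (e⁻¹ g) = e'⁻¹ (p g) := fun g => by
    apply e'.injective
    rw [← h, MulAut.apply_inv_self, MulAut.apply_inv_self]
  induction n generalizing g with
  | zero => simp
  | succ n ih => rw [zpow_add_one, zpow_add_one, MulAut.mul_apply, MulAut.mul_apply, ih, h]
  | pred n ih =>
    rw [zpow_sub_one, zpow_sub_one, MulAut.mul_apply, MulAut.mul_apply, ih, hinv]

/-- The multiplicative 2-cocycle condition with trivial action. -/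
def IsTrivCocycle (f : G → G → M) : Prop :=
  ∀ x y z, f (x * y) z * f x y = f x (y * z) * f y z

lemma IsTrivCocycle.map_one_left {f : G → G → M} (hf : IsTrivCocycle f) (x : G) :
    f 1 x = f 1 1 := by
  simpa using (hf 1 1 x).symm

lemma IsTrivCocycle.map_one_right {f : G → G → M} (hf : IsTrivCocycle f) (x : G) :
    f x 1 = f 1 1 := by
  simpa using hf x 1 1

/-- Two quotients of a group by the same kernel are isomorphic. -/
lemma AddMonoidHom.nonempty_addEquiv_of_ker_eq {B C D : Type*} [AddGroup B] [AddGroup C]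
    [AddGroup D] (φ : B →+ C) (ψ : B →+ D) (hφ : Function.Surjective φ)
    (hψ : Function.Surjective ψ) (h : φ.ker = ψ.ker) : Nonempty (C ≃+ D) :=
  ⟨(QuotientAddGroup.quotientKerEquivOfSurjective φ hφ).symm.trans
    ((QuotientAddGroup.quotientAddEquivOfEq h).trans
      (QuotientAddGroup.quotientKerEquivOfSurjective ψ hψ))⟩

/-- A function measuring the failure of a map `s` to be multiplicative, with values in a
central subgroup, is a 2-cocycle. -/
lemma IsTrivCocycle.of_section (ι : M →* H) (hι : Function.Injective ι)
    (hc : ∀ u k, Commute (ι u) k) (s : G → H) (f : G → G → M)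
    (hs : ∀ x y, s x * s y = ι (f x y) * s (x * y)) : IsTrivCocycle f := by
  intro x y z
  apply hι
  apply mul_right_cancel (b := s (x * y * z))
  calc ι (f (x * y) z * f x y) * s (x * y * z)
      = s x * s y * s z := by
        rw [mul_comm (f _ _), map_mul, mul_assoc, ← hs, hs x y, mul_assoc]
    _ = ι (f x (y * z) * f y z) * s (x * y * z) := by
        rw [mul_assoc, hs y z, ← mul_assoc, ← (hc _ (s x)).eq, mul_assoc, hs, mul_comm (f x _),
          map_mul, mul_assoc, mul_assoc x]

/-- The central extension of `G` by `M` attached to a 2-cocycle. -/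
@[ext]
structure CocycleExt (f : G → G → M) (hf : IsTrivCocycle f) where
  /-- The coordinate in the kernel. -/
  fib : M
  /-- The projection to the quotient. -/
  base : G

namespace CocycleExt

variable {f : G → G → M} {hf : IsTrivCocycle f}

instance : Mul (CocycleExt f hf) :=
  ⟨fun p q => ⟨p.fib * q.fib * f p.base q.base, p.base * q.base⟩⟩

instance : One (CocycleExt f hf) := ⟨⟨(f 1 1)⁻¹, 1⟩⟩

instance : Inv (CocycleExt f hf) :=
  ⟨fun p => ⟨(f 1 1)⁻¹ * p.fib⁻¹ * (f p.base⁻¹ p.base)⁻¹, p.base⁻¹⟩⟩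

@[simp] lemma mul_fib (p q : CocycleExt f hf) :
    (p * q).fib = p.fib * q.fib * f p.base q.base := rfl
@[simp] lemma mul_base (p q : CocycleExt f hf) : (p * q).base = p.base * q.base := rfl
@[simp] lemma one_fib : (1 : CocycleExt f hf).fib = (f 1 1)⁻¹ := rfl
@[simp] lemma one_base : (1 : CocycleExt f hf).base = 1 := rfl
@[simp] lemma inv_fib (p : CocycleExt f hf) :
    p⁻¹.fib = (f 1 1)⁻¹ * p.fib⁻¹ * (f p.base⁻¹ p.base)⁻¹ := rfl
@[simp] lemma inv_base (p : CocycleExt f hf) : p⁻¹.base = p.base⁻¹ := rfl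

instance : Group (CocycleExt f hf) :=
  Group.ofLeftAxioms
    (fun p q r => by
      ext
      · have h := hf p.base q.base r.base
        simp only [mul_fib, mul_base]
        calc _ = p.fib * q.fib * r.fib * (f (p.base * q.base) r.base * f p.base q.base) := by
              simp only [mul_comm, mul_left_comm]
          _ = _ := by
              rw [h]
              simp only [mul_comm, mul_left_comm]
      · exact mul_assoc _ _ _)
    (fun p => by
      ext
      · simp [hf.map_one_left, mul_comm]
      · exact one_mul _)
    (fun p => by
      ext
      · simp only [mul_fib, inv_fib, inv_base, one_fib]
        rw [mul_right_comm, inv_mul_cancel_right, inv_mul_cancel_right]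
      · exact inv_mul_cancel _)

/-- The projection of the extension onto its quotient. -/
def proj (hf : IsTrivCocycle f) : CocycleExt f hf →* G where
  toFun := base
  map_one' := rfl
  map_mul' _ _ := rfl

/-- The inclusion of the central kernel. -/
def incl (hf : IsTrivCocycle f) : M →* CocycleExt f hf where
  toFun u := ⟨u * (f 1 1)⁻¹, 1⟩
  map_one' := by ext <;> simp
  map_mul' u v := by ext <;> simp [mul_comm, mul_left_comm, mul_assoc]

lemma incl_mul (u : M) (p : CocycleExt f hf) : incl hf u * p = ⟨u * p.fib, p.base⟩ := by
  ext <;> simp [incl, hf.map_one_left, mul_right_comm]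

lemma mul_incl (u : M) (p : CocycleExt f hf) : p * incl hf u = ⟨u * p.fib, p.base⟩ := by
  ext <;> simp [incl, hf.map_one_right, mul_comm, ← mul_assoc]

lemma incl_injective : Function.Injective (incl hf) := fun u v h => by
  simpa [incl] using congrArg fib h

end CocycleExt

end CentralExtension

section Comparison

open Multiplicative (ofAdd toAdd)

variable {A : Type} [AddCommGroup A] {M : Type} [CommGroup M] {σ : A ≃+ A}

/-- The inclusion of `A` in the semidirect product. -/
def sdBase (σ : A ≃+ A) (x : A) : sdGroup A σ := SemidirectProduct.inl (ofAdd x)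

/-- The Frobenius generator of the factor `ℤ`. -/
def sdFrob (σ : A ≃+ A) : sdGroup A σ := SemidirectProduct.inr (ofAdd 1)

lemma sdBase_add (x y : A) : sdBase σ (x + y) = sdBase σ x * sdBase σ y := by
  simp [sdBase]

lemma sdFrob_mul_sdBase (x : A) : sdFrob σ * sdBase σ x = sdBase σ (σ x) * sdFrob σ := by
  apply SemidirectProduct.ext
  · change 1 * (AddEquiv.toMultiplicative σ ^ (1 : ℤ)) (ofAdd x) =
      ofAdd (σ x) * (AddEquiv.toMultiplicative σ ^ (0 : ℤ)) 1
    simp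
  · rfl

lemma isCompat_restrict {f : sdGroup A σ → sdGroup A σ → M} (hf : IsTrivCocycle f) :
    IsCompat A M σ (fun x y => f (sdBase σ x) (sdBase σ y))
      (fun x => f (sdFrob σ) (sdBase σ x) * (f (sdBase σ (σ x)) (sdFrob σ))⁻¹) := by
  intro x y
  have h₁ := hf (sdFrob σ) (sdBase σ x) (sdBase σ y)
  have h₂ := hf (sdBase σ (σ x)) (sdFrob σ) (sdBase σ y)
  have h₃ := hf (sdBase σ (σ x)) (sdBase σ (σ y)) (sdFrob σ)
  rw [sdFrob_mul_sdBase, ← sdBase_add] at h₁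
  rw [sdFrob_mul_sdBase] at h₂
  rw [← sdBase_add, ← map_add] at h₃
  have key : ∀ {B : Type} [AddCommGroup B] {u v p q c d x y s t : B},
      u + x = p + d → u + s = v + y → q + c = v + t →
      c + -d = p + -q + -(x + -s) + -(y + -t) := by
    intros
    grind
  exact key (B := Additive M) h₁ h₂ h₃

/-- Restriction of a 2-cocycle on the semidirect product to a quasicharacter datum. -/
def restrictDatum (f : sdGroup A σ → sdGroup A σ → M) (hf : IsTrivCocycle f) : ZQ A M σ :=
  ⟨(fun x y => f (sdBase σ x) (sdBase σ y),
    fun x => f (sdFrob σ) (sdBase σ x) * (f (sdBase σ (σ x)) (sdFrob σ))⁻¹),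
    fun x y z => by simpa only [sdBase_add] using hf (sdBase σ x) (sdBase σ y) (sdBase σ z),
    isCompat_restrict hf⟩

/-- A cocycle whose restriction is a coboundary datum is a coboundary. -/
lemma exists_eq_of_restrictDatum_mem_BQ {f : sdGroup A σ → sdGroup A σ → M}
    (hf : IsTrivCocycle f) (h : (restrictDatum f hf : (A → A → M) × (A → M)) ∈ BQ A M σ) :
    ∃ c : sdGroup A σ → M, ∀ g k, c g * c k * f g k = c (g * k) := by
  obtain ⟨d, hd⟩ := h
  have ha : ∀ x y, d (x + y) * (d x)⁻¹ * (d y)⁻¹ = f (sdBase σ x) (sdBase σ y) := fun x y =>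
    congrFun (congrFun (congrArg Prod.fst hd) x) y
  have hb : ∀ x, d (σ x) * (d x)⁻¹ =
      f (sdFrob σ) (sdBase σ x) * (f (sdBase σ (σ x)) (sdFrob σ))⁻¹ := fun x =>
    congrFun (congrArg Prod.snd hd) x
  let r : Multiplicative A →* CocycleExt f hf :=
    MonoidHom.mk' (fun x => ⟨d x.toAdd, sdBase σ x.toAdd⟩) (fun x y => by
      ext1
      · change d (x.toAdd + y.toAdd) = d x.toAdd * d y.toAdd * f _ _
        rw [← ha, mul_assoc _ (d x.toAdd)⁻¹, ← mul_inv, mul_comm, inv_mul_cancel_right]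
      · simp [sdBase_add])
  let t : CocycleExt f hf := ⟨1, sdFrob σ⟩
  have hr : ∀ x, r (AddEquiv.toMultiplicative σ x) = MulAut.conj t (r x) := fun x => by
    rw [MulAut.conj_apply, eq_mul_inv_iff_mul_eq]
    ext1
    · have := hb x.toAdd
      rw [← div_eq_mul_inv, ← div_eq_mul_inv, div_eq_div_iff_mul_eq_mul] at this
      simpa [r, t, mul_comm] using this
    · exact (sdFrob_mul_sdBase _).symm
  let s : sdGroup A σ →* CocycleExt f hf :=
    SemidirectProduct.lift r (zpowersHom _ t) (fun n => by
      refine MonoidHom.ext fun x => (r.semiconj_zpow hr n.toAdd x).trans ?_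
      rw [← map_zpow]
      rfl)
  have hs : (CocycleExt.proj hf).comp s = MonoidHom.id _ := by
    apply SemidirectProduct.hom_ext
    · refine MonoidHom.ext fun x => ?_
      change (s (SemidirectProduct.inl x)).base = SemidirectProduct.inl x
      rw [SemidirectProduct.lift_inl]
      rfl
    · refine MonoidHom.ext_mint ?_
      change (s (SemidirectProduct.inr (ofAdd 1))).base = sdFrob σ
      rw [SemidirectProduct.lift_inr]
      simp [t]
  have hs' : ∀ g, (s g).base = g := fun g => DFunLike.congr_fun hs g
  refine ⟨fun g => (s g).fib, fun g k => ?_⟩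
  simp only [map_mul, CocycleExt.mul_fib, hs']

lemma restrictDatum_mem_BQ_iff {f : sdGroup A σ → sdGroup A σ → M} (hf : IsTrivCocycle f) :
    (restrictDatum f hf : (A → A → M) × (A → M)) ∈ BQ A M σ ↔
      ∃ c : sdGroup A σ → M, ∀ g k, c g * c k * f g k = c (g * k) := by
  refine ⟨exists_eq_of_restrictDatum_mem_BQ hf, ?_⟩
  rintro ⟨c, hc⟩
  refine ⟨fun x => c (sdBase σ x), Prod.ext (funext fun x => funext fun y => ?_)
    (funext fun x => ?_)⟩
  · change c (sdBase σ (x + y)) * (c (sdBase σ x))⁻¹ * (c (sdBase σ y))⁻¹ =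
      f (sdBase σ x) (sdBase σ y)
    rw [sdBase_add, ← hc, mul_assoc _ (c _)⁻¹, ← mul_inv, mul_inv_eq_iff_eq_mul, mul_comm]
  · change c (sdBase σ (σ x)) * (c (sdBase σ x))⁻¹ =
      f (sdFrob σ) (sdBase σ x) * (f (sdBase σ (σ x)) (sdFrob σ))⁻¹
    have h := hc (sdFrob σ) (sdBase σ x)
    rw [sdFrob_mul_sdBase, ← hc (sdBase σ (σ x))] at h
    rw [← div_eq_mul_inv, ← div_eq_mul_inv, div_eq_div_iff_mul_eq_mul]
    apply mul_left_cancel (a := c (sdFrob σ))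
    rw [← mul_assoc, mul_comm _ (c (sdBase σ (σ x))), ← h, mul_assoc, mul_comm (f _ _)]

/-- Every quasicharacter datum is the restriction of a cocycle. -/
lemma exists_restrictDatum_eq (p : ZQ A M σ) :
    ∃ (f : sdGroup A σ → sdGroup A σ → M) (hf : IsTrivCocycle f), restrictDatum f hf = p := by
  obtain ⟨⟨a, b⟩, ha, hb⟩ := p
  let a' : Multiplicative A → Multiplicative A → M := fun x y => a x.toAdd y.toAdd
  have ha' : IsTrivCocycle a' := fun x y z => ha _ _ _
  have hb' : ∀ x y, b (x + y) * a x y = b x * b y * a (σ x) (σ y) := fun x y => by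
    have h : a (σ x) (σ y) * (a x y)⁻¹ = b (x + y) * (b x)⁻¹ * (b y)⁻¹ := hb x y
    rw [mul_assoc (b _), ← mul_inv, ← div_eq_mul_inv, ← div_eq_mul_inv,
      div_eq_div_iff_mul_eq_mul] at h
    rw [← h, mul_comm]
  have hb0 : b 0 = 1 := by simpa using hb' 0 0
  let e : MulAut (CocycleExt a' ha') := MulEquiv.mk'
    { toFun := fun p => ⟨p.fib * b p.base.toAdd, ofAdd (σ p.base.toAdd)⟩
      invFun := fun p => ⟨p.fib * (b (σ.symm p.base.toAdd))⁻¹, ofAdd (σ.symm p.base.toAdd)⟩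
      left_inv := fun p => by ext1 <;> simp
      right_inv := fun p => by ext1 <;> simp }
    (fun p q => by
      ext1
      · have := hb' p.base.toAdd q.base.toAdd
        simp only [CocycleExt.mul_fib, CocycleExt.mul_base, Equiv.coe_fn_mk, toAdd_mul, a',
          toAdd_ofAdd]
        rw [mul_assoc, mul_comm (a _ _), this]
        simp only [mul_left_comm, mul_assoc]
      · simp)
  have he_incl : ∀ (n : ℤ) u, (e ^ n) (CocycleExt.incl ha' u) = CocycleExt.incl ha' u :=
      fun n u => by
    have := (CocycleExt.incl ha').semiconj_zpow (e := 1) (e' := e)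
      (fun u => by
        apply CocycleExt.ext
        · change u * (a' 1 1)⁻¹ = u * (a' 1 1)⁻¹ * b 0
          rw [hb0, mul_one]
        · exact (map_zero σ).symm) n u
    simpa using this.symm
  have he_base : ∀ (n : Multiplicative ℤ) q, ((e ^ n.toAdd) q).base = sdAct A σ n q.base :=
    fun n q => (CocycleExt.proj ha').semiconj_zpow (e := e) (e' := AddEquiv.toMultiplicative σ)
      (fun q => rfl) n.toAdd q
  let K := SemidirectProduct (CocycleExt a' ha') (Multiplicative ℤ) (zpowersHom _ e)
  let ι : M →* K := SemidirectProduct.inl.comp (CocycleExt.incl ha')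
  let s : sdGroup A σ → K := fun g => ⟨⟨1, g.left⟩, g.right⟩
  let f : sdGroup A σ → sdGroup A σ → M := fun g k =>
    ((e ^ g.right.toAdd) ⟨1, k.left⟩).fib * a' g.left (sdAct A σ g.right k.left)
  have hf : IsTrivCocycle f := by
    refine IsTrivCocycle.of_section ι
      (SemidirectProduct.inl_injective.comp CocycleExt.incl_injective) (fun u k => ?_) s f
      (fun g k => ?_)
    · apply SemidirectProduct.ext
      · change CocycleExt.incl ha' u * (e ^ (0 : ℤ)) k.left =
          k.left * (e ^ k.right.toAdd) (CocycleExt.incl ha' u)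
        rw [he_incl, CocycleExt.mul_incl, zpow_zero, MulAut.one_apply, CocycleExt.incl_mul]
      · exact mul_comm _ _
    · apply SemidirectProduct.ext
      · change (⟨1, g.left⟩ : CocycleExt a' ha') * (e ^ g.right.toAdd) ⟨1, k.left⟩ =
          CocycleExt.incl ha' (f g k) *
            (e ^ (0 : ℤ)) ⟨1, g.left * sdAct A σ g.right k.left⟩
        rw [zpow_zero, MulAut.one_apply, CocycleExt.incl_mul]
        ext1
        · simp [f, he_base]
        · simp [he_base]
      · exact (one_mul _).symm
  refine ⟨f, hf, Subtype.ext (Prod.ext ?_ ?_)⟩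
  · funext x y
    exact one_mul _
  · funext x
    have h₁ : f (sdFrob σ) (sdBase σ x) = b x * a 0 0 := by
      rw [← show a 0 (σ x) = a 0 0 from ha'.map_one_left (ofAdd (σ x))]
      exact congrArg (· * _) (one_mul _)
    have h₂ : f (sdBase σ (σ x)) (sdFrob σ) = a 0 0 := by
      rw [← show a (σ x) 0 = a 0 0 from ha'.map_one_right (ofAdd (σ x))]
      exact one_mul _
    change f _ _ * (f _ _)⁻¹ = b x
    rw [h₁, h₂, mul_inv_cancel_right]

lemma mem_cocycles₂_trivial_iff {G M : Type} [Group G] [CommGroup M] (f : G × G → Additive M) :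
    f ∈ groupCohomology.cocycles₂ (Rep.trivial ℤ G (Additive M)) ↔
      IsTrivCocycle (fun g k => (f (g, k)).toMul) := by
  refine (groupCohomology.mem_cocycles₂_iff (A := Rep.trivial ℤ G (Additive M)) f).trans ?_
  refine forall_congr' fun x => forall_congr' fun y => forall_congr' fun z => ?_
  exact Eq.congr_right (add_comm (f (y, z)) (f (x, y * z)))

lemma mem_coboundaries₂_trivial_iff {G M : Type} [Group G] [CommGroup M]
    (f : G × G → Additive M) :
    f ∈ groupCohomology.coboundaries₂ (Rep.trivial ℤ G (Additive M)) ↔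
      ∃ c : G → M, ∀ g k, c g * c k * (f (g, k)).toMul = c (g * k) := by
  have hd : ∀ c : G → Additive M, (∀ g k, c k - c (g * k) + c g = f (g, k)) ↔
      (groupCohomology.d₁₂ (Rep.trivial ℤ G (Additive M))).hom c = f := fun c =>
    ⟨fun h => funext fun g => h g.1 g.2, fun h g k => congrFun h (g, k)⟩
  have key : ∀ {x y z w : Additive M}, y - z + x = w ↔ -x + -y + w = -z := by
    intros
    constructor <;> intro <;> grind
  constructor
  · rintro ⟨c, hc⟩
    exact ⟨fun g => (Additive.toMul (c g))⁻¹, fun g k => key.1 ((hd c).2 hc g k)⟩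
  · rintro ⟨c, hc⟩
    refine ⟨fun g => -Additive.ofMul (c g), (hd _).1 fun g k => key.2 ?_⟩
    rw [neg_neg, neg_neg, neg_neg]
    exact hc g k

variable (A M σ) in
/-- Restriction of 2-cocycles on the semidirect product, as a homomorphism. -/
def restrictHom :
    groupCohomology.cocycles₂ (Rep.trivial ℤ (sdGroup A σ) (Additive M)) →+
      Additive (ZQ A M σ) where
  toFun f := .ofMul (restrictDatum (fun g k => Additive.toMul (α := M) (f.1 (g, k)))
    ((mem_cocycles₂_trivial_iff (M := M) f.1).1 f.2))
  map_zero' := Subtype.ext (Prod.ext rfl (funext fun _ => mul_inv_cancel 1))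
  map_add' f g := Subtype.ext (Prod.ext rfl (funext fun _ => by
    exact (congrArg _ (mul_inv _ _)).trans (mul_mul_mul_comm _ _ _ _)))

lemma restrictHom_surjective : Function.Surjective (restrictHom A M σ) := fun p => by
  obtain ⟨f, hf, h⟩ := exists_restrictDatum_eq p.toMul
  exact ⟨⟨fun g => .ofMul (f g.1 g.2), (mem_cocycles₂_trivial_iff _).2 hf⟩, h⟩

lemma restrictHom_mem_BQ_iff
    (f : groupCohomology.cocycles₂ (Rep.trivial ℤ (sdGroup A σ) (Additive M))) :
    ((restrictHom A M σ f).toMul : (A → A → M) × (A → M)) ∈ BQ A M σ ↔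
      f.1 ∈ groupCohomology.coboundaries₂ (Rep.trivial ℤ (sdGroup A σ) (Additive M)) := by
  exact (restrictDatum_mem_BQ_iff _).trans (mem_coboundaries₂_trivial_iff (M := M) f.1).symm

end Comparison

/-- There is a group isomorphism
`HQ(A,σ,Eˣ) ≅ H²(A ⋊_σ ℤ, Eˣ)`, where the right-hand side is the second group cohomology
of the semidirect product `A ⋊_σ ℤ` with coefficients in the trivial module `Eˣ`. -/
theorem HQ_iso_H2_of_semidirect_product
    (E : Type) [Field E] [IsAlgClosed E] [CharZero E]
    (A : Type) [AddCommGroup A] (σ : A ≃+ A) :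
    Nonempty (Additive (HQ A Eˣ σ) ≃+
      groupCohomology (Rep.trivial ℤ (sdGroup A σ) (Additive Eˣ)) 2) := by
  let q : Additive (ZQ A Eˣ σ) →+ Additive (HQ A Eˣ σ) :=
    MonoidHom.toAdditive (QuotientGroup.mk' ((BQ A Eˣ σ).subgroupOf (ZQ A Eˣ σ)))
  have hq : Function.Surjective q :=
    QuotientGroup.mk'_surjective ((BQ A Eˣ σ).subgroupOf (ZQ A Eˣ σ))
  let φ : groupCohomology.cocycles₂ (Rep.trivial ℤ (sdGroup A σ) (Additive Eˣ)) →+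
      Additive (HQ A Eˣ σ) := q.comp (restrictHom A Eˣ σ)
  let ψ : groupCohomology.cocycles₂ (Rep.trivial ℤ (sdGroup A σ) (Additive Eˣ)) →+
      groupCohomology (Rep.trivial ℤ (sdGroup A σ) (Additive Eˣ)) 2 :=
    (groupCohomology.H2π (Rep.trivial ℤ (sdGroup A σ) (Additive Eˣ))).hom.toAddMonoidHom
  have hφ : Function.Surjective φ := hq.comp restrictHom_surjective
  have hψ : Function.Surjective ψ :=
    (ModuleCat.epi_iff_surjective
      (groupCohomology.H2π (Rep.trivial ℤ (sdGroup A σ) (Additive Eˣ)))).1 inferInstance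
  have hker : φ.ker = ψ.ker := by
    refine AddSubgroup.ext fun f => ?_
    exact (QuotientGroup.eq_one_iff (restrictHom A Eˣ σ f).toMul).trans
      ((restrictHom_mem_BQ_iff f).trans (groupCohomology.H2π_eq_zero_iff f).symm)
  exact AddMonoidHom.nonempty_addEquiv_of_ker_eq (C := Additive (HQ A Eˣ σ)) φ ψ hφ hψ hker
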